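/- arXiv:1502.07118 — 2 statements merged into one kernel-verified Lean document; each statement's English description precedes it below -/
import Mathlib

section
/- For queue, local linearizability is incomparable to sequential consistency: (i) there exists a concurrent history over Σ_Q that is sequentially consistent with respect to S_Q but not locally linearizable with respect to S_Q; and (ii) there exists a concurrent history over Σ_Q that is locally linearizable with respect to S_Q but not sequentially consistent with respect to S_Q. -/
namespace LL

universe u v w

/-- Method calls of a container alphabet: insertions `ins x` of a value `x ∈ V`,
and removals `rem v` of a value `v ∈ V` or returning an "empty" value in `E`. -/
inductive CMethod (V : Type u) (E : Type v) where
  | ins : V → CMethod V E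
  | rem : V ⊕ E → CMethod V E

/-- Events of a concurrent history: invocations and responses of method calls
in `σ`, tagged with a thread identifier in `I`. -/
inductive Event (σ : Type u) (I : Type v) where
  | inv : σ → I → Event σ I
  | res : σ → I → Event σ I

variable {σ : Type*} {I : Type*} {V : Type*} {E : Type*} {α : Type*}

/-- The method call of an event. -/
def Event.method : Event σ I → σ
  | .inv m _ => m
  | .res m _ => m

/-- The thread identifier of an event. -/
def Event.thread : Event σ I → I
  | .inv _ k => k
  | .res _ k => k

/-- Whether an event is an invocation. -/
def Event.isInv : Event σ I → Bool
  | .inv _ _ => true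
  | .res _ _ => false

/-- `a` occurs (strictly) before `b` in the sequence `s`. -/
def OccursBefore (s : List α) (a b : α) : Prop :=
  ∃ i j : Fin s.length, i < j ∧ s.get i = a ∧ s.get j = b

/-- A set of sequences is prefix-closed. -/
def PrefixClosed (S : Set (List α)) : Prop :=
  ∀ s ∈ S, ∀ t : List α, t <+: s → t ∈ S

open Classical in
/-- The subsequence of events of thread `k`. -/
noncomputable def threadEvents (h : List (Event σ I)) (k : I) : List (Event σ I) :=
  h.filter fun e => decide (e.thread = k)

/-- `h` is a well-formed concurrent history: no event occurs twice, each method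
call is invoked at most once, every response is preceded by its matching
invocation, and in every thread's subsequence of events each invocation is
immediately followed by its matching response. -/
structure IsHistory (h : List (Event σ I)) : Prop where
  nodup : h.Nodup
  invUnique : ∀ (i j : Fin h.length) (m : σ) (k k' : I),
      h.get i = Event.inv m k → h.get j = Event.inv m k' → i = j
  resMatched : ∀ (j : Fin h.length) (m : σ) (k : I), h.get j = Event.res m k →
      ∃ i : Fin h.length, i < j ∧ h.get i = Event.inv m k
  threadSeq : ∀ (k : I) (i : ℕ) (m : σ),
      (threadEvents h k)[i]? = some (Event.inv m k) →
      ∀ e : Event σ I, (threadEvents h k)[i + 1]? = some e → e = Event.res m k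

/-- The method call `m` appears in `h` (its invocation occurs in `h`). -/
def Appears (h : List (Event σ I)) (m : σ) : Prop :=
  ∃ k : I, Event.inv m k ∈ h

/-- `h` is complete: every invocation has its matching response in `h`. -/
def HistComplete (h : List (Event σ I)) : Prop :=
  ∀ (m : σ) (k : I), Event.inv m k ∈ h → Event.res m k ∈ h

/-- The method call `m` (executed by thread `k`) is pending in `h`. -/
def PendingCall (h : List (Event σ I)) (m : σ) (k : I) : Prop :=
  Event.inv m k ∈ h ∧ Event.res m k ∉ h

/-- `hc` is a completion of `h`: a complete well-formed history obtained from `h`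
by deleting some pending invocations and appending matching responses for the
remaining pending invocations. -/
def IsCompletionOf (hc h : List (Event σ I)) : Prop :=
  IsHistory hc ∧ HistComplete hc ∧
  ∃ h' r : List (Event σ I),
    h'.Sublist h ∧
    (∀ e ∈ h, e ∉ h' → ∃ (m : σ) (k : I), e = Event.inv m k ∧ PendingCall h m k) ∧
    (∀ e ∈ r, ∃ (m : σ) (k : I), e = Event.res m k ∧ PendingCall h m k) ∧
    hc = h' ++ r

/-- The precedence order of `h`: `m <_h n` iff the response of `m` occurs in `h`
before the invocation of `n`. -/
def Precedes (h : List (Event σ I)) (m n : σ) : Prop :=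
  ∃ (i j : Fin h.length) (k k' : I),
    i < j ∧ h.get i = Event.res m k ∧ h.get j = Event.inv n k'

/-- The sequence of method calls of a history (in invocation order). -/
def methodList (h : List (Event σ I)) : List σ :=
  (h.filter Event.isInv).map Event.method

/-- `h` is linearizable wrt the sequential specification `S`. -/
def Linearizable (S : Set (List σ)) (h : List (Event σ I)) : Prop :=
  ∃ hc : List (Event σ I), IsCompletionOf hc h ∧
    ∃ s ∈ S, s.Perm (methodList hc) ∧
      ∀ m n : σ, Precedes hc m n → OccursBefore s m n

/-- `h` is sequentially consistent wrt `S`. -/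
def SeqConsistent (S : Set (List σ)) (h : List (Event σ I)) : Prop :=
  ∃ hc : List (Event σ I), IsCompletionOf hc h ∧
    ∃ s ∈ S, s.Perm (methodList hc) ∧
      ∀ m n : σ, Precedes hc m n →
        (∃ k : I, Event.inv m k ∈ hc ∧ Event.inv n k ∈ hc) →
        OccursBefore s m n

/-- Position `p` is a quiescent state of `h`: every invocation occurring before
position `p` has its matching response before position `p`. -/
def QuiescentAt (h : List (Event σ I)) (p : ℕ) : Prop :=
  ∀ (i : Fin h.length) (m : σ) (k : I), (i : ℕ) < p → h.get i = Event.inv m k →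
    ∃ j : Fin h.length, (j : ℕ) < p ∧ h.get j = Event.res m k

/-- `h` is quiescently consistent wrt `S`. -/
def QuiescentConsistent (S : Set (List σ)) (h : List (Event σ I)) : Prop :=
  ∃ hc : List (Event σ I), IsCompletionOf hc h ∧
    ∃ s ∈ S, s.Perm (methodList hc) ∧
      ∀ m n : σ,
        (∃ p : ℕ, QuiescentAt hc p ∧
          (∃ (i : Fin hc.length) (k : I), (i : ℕ) < p ∧ hc.get i = Event.res m k) ∧
          (∃ (j : Fin hc.length) (k : I), p ≤ (j : ℕ) ∧ hc.get j = Event.inv n k)) →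
        OccursBefore s m n

/-- Membership of a method call in `I_T ∪ O_T`: insertions performed by thread
`T` in `h`, removals of values inserted by `T` in `h`, and removals returning an
"empty" value. -/
def InducedMethod (h : List (Event (CMethod V E) I)) (T : I) : CMethod V E → Prop
  | .ins x => Event.inv (CMethod.ins x) T ∈ h
  | .rem (Sum.inl x) => Event.inv (CMethod.ins x) T ∈ h
  | .rem (Sum.inr _) => True

open Classical in
/-- The thread-induced history `h_T`: the subsequence of `h` of events of method
calls in `I_T ∪ O_T`. -/
noncomputable def threadInduced (h : List (Event (CMethod V E) I)) (T : I) :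
    List (Event (CMethod V E) I) :=
  h.filter fun e => decide (InducedMethod h T e.method)

/-- `h` is locally linearizable wrt `S`: every thread-induced history is
linearizable wrt `S`, and the thread-induced histories decompose `h`. -/
def LocallyLinearizable (S : Set (List (CMethod V E)))
    (h : List (Event (CMethod V E) I)) : Prop :=
  (∀ T : I, Linearizable S (threadInduced h T)) ∧
  (∀ m : CMethod V E, Appears h m → ∃ T : I, InducedMethod h T m)

/-- The pool sequential specification `S_P`. -/
def poolSpec (V : Type u) (E : Type v) : Set (List (CMethod V E)) :=
  { s | s.Nodup ∧
    (∀ x : V, CMethod.rem (Sum.inl x) ∈ s →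
      CMethod.ins x ∈ s ∧
      OccursBefore s (CMethod.ins x) (CMethod.rem (Sum.inl x))) ∧
    (∀ (e : E) (x : V),
      OccursBefore s (CMethod.ins x) (CMethod.rem (Sum.inr e)) →
      CMethod.rem (Sum.inl x) ∈ s ∧
      OccursBefore s (CMethod.rem (Sum.inl x)) (CMethod.rem (Sum.inr e))) }

/-- The queue sequential specification `S_Q` (pool axioms plus queue order). -/
def queueSpec (V : Type u) (E : Type v) : Set (List (CMethod V E)) :=
  { s | s ∈ poolSpec V E ∧
    ∀ x y : V, OccursBefore s (CMethod.ins x) (CMethod.ins y) →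
      CMethod.rem (Sum.inl y) ∈ s →
      CMethod.rem (Sum.inl x) ∈ s ∧
      OccursBefore s (CMethod.rem (Sum.inl x)) (CMethod.rem (Sum.inl y)) }

/-- The stack sequential specification `S_S` (pool axioms plus stack order). -/
def stackSpec (V : Type u) (E : Type v) : Set (List (CMethod V E)) :=
  { s | s ∈ poolSpec V E ∧
    ∀ x y : V, OccursBefore s (CMethod.ins x) (CMethod.ins y) →
      OccursBefore s (CMethod.ins y) (CMethod.rem (Sum.inl x)) →
      CMethod.rem (Sum.inl y) ∈ s ∧
      OccursBefore s (CMethod.rem (Sum.inl y)) (CMethod.rem (Sum.inl x)) }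

/-- A method call's value lies in `V' ∪ Emp`. -/
def ProjKeep (V' : Set V) : CMethod V E → Prop
  | .ins x => x ∈ V'
  | .rem (Sum.inl x) => x ∈ V'
  | .rem (Sum.inr _) => True

open Classical in
/-- The data-projection of a sequence: the subsequence of method calls whose
value lies in `V' ∪ Emp`. -/
noncomputable def dataProj (V' : Set V) (s : List (CMethod V E)) :
    List (CMethod V E) :=
  s.filter fun m => decide (ProjKeep V' m)

/-- `S` is closed under data-projection. -/
def ClosedUnderDataProjection (S : Set (List (CMethod V E))) : Prop :=
  ∀ s ∈ S, ∀ V' : Set V, dataProj V' s ∈ S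

end LL

namespace LL

section OccursBefore

variable {α : Type*}

theorem occursBefore_nil (a b : α) : ¬ OccursBefore [] a b := by
  rintro ⟨i, -⟩
  exact i.elim0

theorem occursBefore_cons (c : α) (s : List α) (a b : α) :
    OccursBefore (c :: s) a b ↔ (c = a ∧ b ∈ s) ∨ OccursBefore s a b := by
  constructor
  · rintro ⟨i, j, hij, ha, hb⟩
    obtain ⟨j', rfl⟩ := Fin.exists_succ_eq.2 (Fin.ne_zero_of_lt hij)
    have hb' : s.get j' = b := hb
    cases i using Fin.cases with
    | zero => exact Or.inl ⟨ha, hb' ▸ List.get_mem s j'⟩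
    | succ i' => exact Or.inr ⟨i', j', Fin.succ_lt_succ_iff.1 hij, ha, hb'⟩
  · rintro (⟨rfl, hb⟩ | ⟨i, j, hij, ha, hb⟩)
    · obtain ⟨j, hj⟩ := List.get_of_mem hb
      exact ⟨(0 : Fin (s.length + 1)), j.succ, Fin.succ_pos j, rfl, hj⟩
    · exact ⟨i.succ, j.succ, Fin.succ_lt_succ_iff.2 hij, ha, hb⟩

theorem OccursBefore.trans {s : List α} (hs : s.Nodup) {a b c : α}
    (hab : OccursBefore s a b) (hbc : OccursBefore s b c) : OccursBefore s a c := by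
  obtain ⟨i, j, hij, hi, hj⟩ := hab
  obtain ⟨j', k, hjk, hj', hk⟩ := hbc
  obtain rfl : j = j' := List.nodup_iff_injective_get.1 hs (hj.trans hj'.symm)
  exact ⟨i, k, hij.trans hjk, hi, hk⟩

theorem OccursBefore.irrefl {s : List α} (hs : s.Nodup) (a : α) : ¬ OccursBefore s a a := by
  rintro ⟨i, j, hij, hi, hj⟩
  exact hij.ne (List.nodup_iff_injective_get.1 hs (hi.trans hj.symm))

end OccursBefore

section Sequential

variable {σ I : Type*}

theorem precedes_iff (h : List (Event σ I)) (m n : σ) :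
    Precedes h m n ↔ ∃ k k', OccursBefore h (Event.res m k) (Event.inv n k') := by
  constructor
  · rintro ⟨i, j, k, k', h⟩
    exact ⟨k, k', i, j, h⟩
  · rintro ⟨k, k', i, j, h⟩
    exact ⟨i, j, k, k', h⟩

theorem IsHistory.isCompletionOf_self {h : List (Event σ I)} (hh : IsHistory h)
    (hc : HistComplete h) : IsCompletionOf h h :=
  ⟨hh, hc, h, [], List.Sublist.refl h, fun _ he hne => absurd he hne, by simp, by simp⟩

theorem IsCompletionOf.eq_of_histComplete {hc h : List (Event σ I)} (hcomp : IsCompletionOf hc h)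
    (hh : h.Nodup) (hfull : HistComplete h) : hc = h := by
  obtain ⟨-, -, h', r, hsub, hdel, happ, rfl⟩ := hcomp
  have hr : r = [] := List.eq_nil_iff_forall_not_mem.2 fun e he => by
    obtain ⟨m, k, -, hinv, hres⟩ := happ e he
    exact hres (hfull m k hinv)
  have hmem : h ⊆ h' := fun e he => by
    by_contra hne
    obtain ⟨m, k, -, hinv, hres⟩ := hdel e he hne
    exact hres (hfull m k hinv)
  rw [hr, List.append_nil]
  exact hsub.eq_of_length_le (List.subperm_of_subset hh hmem).length_le

/-- The sequential history performing the given method calls one after the other. -/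
def seqHist : List (σ × I) → List (Event σ I)
  | [] => []
  | p :: l => Event.inv p.1 p.2 :: Event.res p.1 p.2 :: seqHist l

theorem inv_mem_seqHist {l : List (σ × I)} {m : σ} {k : I} :
    Event.inv m k ∈ seqHist l ↔ (m, k) ∈ l := by
  induction l with
  | nil => simp [seqHist]
  | cons p l ih => simp [seqHist, ih, Prod.ext_iff]

theorem res_mem_seqHist {l : List (σ × I)} {m : σ} {k : I} :
    Event.res m k ∈ seqHist l ↔ (m, k) ∈ l := by
  induction l with
  | nil => simp [seqHist]
  | cons p l ih => simp [seqHist, ih, Prod.ext_iff]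

theorem histComplete_seqHist (l : List (σ × I)) : HistComplete (seqHist l) :=
  fun _ _ h => res_mem_seqHist.2 (inv_mem_seqHist.1 h)

theorem methodList_seqHist (l : List (σ × I)) : methodList (seqHist l) = l.map Prod.fst := by
  induction l with
  | nil => rfl
  | cons p l ih =>
    simpa [methodList, seqHist, List.filter_cons, Event.isInv, Event.method] using ih

theorem occursBefore_res_inv_seqHist {l : List (σ × I)} {m n : σ} {k k' : I} :
    OccursBefore (seqHist l) (Event.res m k) (Event.inv n k') ↔
      OccursBefore l (m, k) (n, k') := by
  induction l with
  | nil => simp [seqHist, occursBefore_nil]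
  | cons p l ih =>
    simp [seqHist, occursBefore_cons, ih, inv_mem_seqHist, Prod.ext_iff]

theorem occursBefore_inv_res_seqHist {l : List (σ × I)} {m : σ} {k : I} (h : (m, k) ∈ l) :
    OccursBefore (seqHist l) (Event.inv m k) (Event.res m k) := by
  induction l with
  | nil => simp at h
  | cons p l ih =>
    rcases List.mem_cons.1 h with rfl | h
    · simp [seqHist, occursBefore_cons]
    · simp [seqHist, occursBefore_cons, ih h]

theorem precedes_seqHist {l : List (σ × I)} {m n : σ} :
    Precedes (seqHist l) m n ↔ ∃ k k', OccursBefore l (m, k) (n, k') := by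
  simp [precedes_iff, occursBefore_res_inv_seqHist]

theorem filter_seqHist (l : List (σ × I)) (f : Event σ I → Bool) (g : σ × I → Bool)
    (hinv : ∀ p, f (Event.inv p.1 p.2) = g p) (hres : ∀ p, f (Event.res p.1 p.2) = g p) :
    (seqHist l).filter f = seqHist (l.filter g) := by
  induction l with
  | nil => rfl
  | cons p l ih => cases hp : g p <;> simp [seqHist, hinv, hres, hp, ih]

theorem nodup_seqHist {l : List (σ × I)} (hl : l.Nodup) : (seqHist l).Nodup := by
  induction l with
  | nil => simp [seqHist]
  | cons p l ih =>
    rw [List.nodup_cons] at hl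
    simp [seqHist, inv_mem_seqHist, res_mem_seqHist, hl.1, ih hl.2]

theorem getElem?_succ_seqHist {l : List (σ × I)} {i : ℕ} {m : σ} {k : I}
    (hi : (seqHist l)[i]? = some (Event.inv m k)) :
    (seqHist l)[i + 1]? = some (Event.res m k) := by
  induction l generalizing i with
  | nil => simp [seqHist] at hi
  | cons p l ih =>
    match i with
    | 0 => simpa [seqHist] using hi
    | 1 => simp [seqHist] at hi
    | i + 2 =>
      simp only [seqHist, List.getElem?_cons_succ] at hi ⊢
      exact ih hi

theorem isHistory_seqHist {l : List (σ × I)} (hl : (l.map Prod.fst).Nodup) :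
    IsHistory (seqHist l) := by
  have hnd : (seqHist l).Nodup := nodup_seqHist hl.of_map
  have hinj := List.nodup_iff_injective_get.1 hnd
  refine ⟨hnd, fun i j m k k' hi hj => hinj ?_, fun j m k hj => ?_, fun k i m hi e he => ?_⟩
  · have h1 : (m, k) ∈ l := inv_mem_seqHist.1 (hi ▸ List.get_mem _ i)
    have h2 : (m, k') ∈ l := inv_mem_seqHist.1 (hj ▸ List.get_mem _ j)
    have := List.inj_on_of_nodup_map hl h1 h2 rfl
    rw [hi, hj, (Prod.mk.inj this).2]
  · obtain ⟨i, j', hij, hi, hj'⟩ :=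
      occursBefore_inv_res_seqHist (res_mem_seqHist.1 (hj ▸ List.get_mem _ j))
    obtain rfl := hinj (hj.trans hj'.symm)
    exact ⟨i, hij, hi⟩
  · classical
    rw [threadEvents, filter_seqHist l _ (fun p => decide (p.2 = k))
      (fun _ => rfl) (fun _ => rfl)] at hi he
    simpa [he] using getElem?_succ_seqHist hi

theorem linearizable_seqHist {S : Set (List σ)} {l : List (σ × I)}
    (hl : (l.map Prod.fst).Nodup) (hS : l.map Prod.fst ∈ S) : Linearizable S (seqHist l) := by
  refine ⟨seqHist l, (isHistory_seqHist hl).isCompletionOf_self (histComplete_seqHist l), _, hS,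
    by rw [methodList_seqHist], fun m n hmn => ?_⟩
  obtain ⟨k, k', i, j, hij, hi, hj⟩ := precedes_seqHist.1 hmn
  refine ⟨i.cast (by simp), j.cast (by simp), hij, ?_, ?_⟩
  · simp_all
  · simp_all

theorem threadInduced_seqHist {V E : Type*} (l : List (CMethod V E × I)) (T : I)
    (g : CMethod V E × I → Bool) (hg : ∀ p, g p = true ↔ InducedMethod (seqHist l) T p.1) :
    threadInduced (seqHist l) T = seqHist (l.filter g) := by
  refine filter_seqHist l _ g (fun p => ?_) (fun p => ?_) <;>
    simp [Event.method, ← hg]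

end Sequential

/-- A dequeue of `x` by one thread, followed by the enqueue of `x` by another one. -/
theorem exists_seqConsistent_not_locallyLinearizable (V E : Type*) {I : Type*} (x : V)
    {T₁ T₂ : I} (hT : T₁ ≠ T₂) :
    ∃ h : List (Event (CMethod V E) I), IsHistory h ∧
      SeqConsistent (queueSpec V E) h ∧ ¬ LocallyLinearizable (queueSpec V E) h := by
  set l : List (CMethod V E × I) := [(.rem (.inl x), T₂), (.ins x, T₁)] with hl
  have hnd : (l.map Prod.fst).Nodup := by simp [hl]
  have hh := isHistory_seqHist hnd
  refine ⟨seqHist l, hh, ⟨seqHist l, hh.isCompletionOf_self (histComplete_seqHist l),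
    [.ins x, .rem (.inl x)], ?_, ?_, ?_⟩, ?_⟩
  · simp [queueSpec, poolSpec, occursBefore_cons, occursBefore_nil]
  · rw [methodList_seqHist]
    exact List.Perm.swap _ _ _
  · rintro m n hmn ⟨k, hm, hn⟩
    simp only [hl, precedes_seqHist, occursBefore_cons, occursBefore_nil] at hmn
    simp only [hl, inv_mem_seqHist] at hm hn
    grind
  · rintro ⟨hlin, -⟩
    classical
    obtain ⟨hc, hcomp, s, hs, hperm, hord⟩ := hlin T₁
    have hind : threadInduced (seqHist l) T₁ = seqHist l := by
      rw [threadInduced, List.filter_eq_self]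
      simp [hl, seqHist, Event.method, InducedMethod]
    rw [hind] at hcomp
    obtain rfl := hcomp.eq_of_histComplete hh.nodup (histComplete_seqHist l)
    rw [methodList_seqHist] at hperm
    have h1 : OccursBefore s (.rem (.inl x)) (.ins x) := hord _ _ <| precedes_seqHist.2
      ⟨T₂, T₁, by simp [hl, occursBefore_cons]⟩
    have h2 := (hs.1.2.1 x (hperm.mem_iff.2 (by simp [hl]))).2
    exact OccursBefore.irrefl hs.1.1 _ (h1.trans hs.1.1 h2)

/-- One thread enqueues `w`, `x`, `y` and dequeues `w`; then another one dequeues `x`, enqueues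
`z` and dequeues `z`. The dequeues of `w` and `x` force the enqueue of `y` before that of `z`. -/
theorem exists_locallyLinearizable_not_seqConsistent (V E : Type*) {I : Type*} {w x y z : V}
    (hwx : w ≠ x) (hwy : w ≠ y) (hwz : w ≠ z) (hxy : x ≠ y) (hxz : x ≠ z) (hyz : y ≠ z)
    {T₁ T₂ : I} (hT : T₁ ≠ T₂) :
    ∃ h : List (Event (CMethod V E) I), IsHistory h ∧
      LocallyLinearizable (queueSpec V E) h ∧ ¬ SeqConsistent (queueSpec V E) h := by
  classical
  set l : List (CMethod V E × I) :=
    [(.ins w, T₁), (.ins x, T₁), (.ins y, T₁), (.rem (.inl w), T₁),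
      (.rem (.inl x), T₂), (.ins z, T₂), (.rem (.inl z), T₂)] with hl
  have hnd : (l.map Prod.fst).Nodup := by simp [*]
  have hh := isHistory_seqHist hnd
  refine ⟨seqHist l, hh, ⟨fun T => ?_, ?_⟩, ?_⟩
  · rw [threadInduced_seqHist l T (fun p => decide (InducedMethod (seqHist l) T p.1)) (by simp)]
    apply linearizable_seqHist
    · exact (List.filter_sublist.map _).nodup hnd
    by_cases h1 : T = T₁
    · subst h1
      simp [InducedMethod, inv_mem_seqHist, queueSpec, poolSpec, occursBefore_cons,
        occursBefore_nil, *, Ne.symm hwz, Ne.symm hxz, Ne.symm hyz]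
      grind
    by_cases h2 : T = T₂
    · subst h2
      simp [InducedMethod, inv_mem_seqHist, queueSpec, poolSpec, occursBefore_cons,
        occursBefore_nil, *]
    · simp [InducedMethod, inv_mem_seqHist, queueSpec, poolSpec, occursBefore_nil, *]
  · rintro m ⟨k, hm⟩
    have hm := inv_mem_seqHist.1 hm
    simp only [hl, List.mem_cons, Prod.mk.injEq, List.not_mem_nil, or_false] at hm
    rcases hm with ⟨rfl, -⟩ | ⟨rfl, -⟩ | ⟨rfl, -⟩ | ⟨rfl, -⟩ | ⟨rfl, -⟩ | ⟨rfl, -⟩ | ⟨rfl, -⟩ <;>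
      simp [InducedMethod, inv_mem_seqHist, hl, exists_or]
  · rintro ⟨hc, hcomp, s, ⟨⟨hs, -⟩, hqueue⟩, hperm, hord⟩
    obtain rfl := hcomp.eq_of_histComplete hh.nodup (histComplete_seqHist l)
    rw [methodList_seqHist] at hperm
    have key (m n : CMethod V E) (k : I) (hmn : OccursBefore l (m, k) (n, k))
        (hm : (m, k) ∈ l) (hn : (n, k) ∈ l) : OccursBefore s m n :=
      hord m n (precedes_seqHist.2 ⟨k, k, hmn⟩) ⟨k, inv_mem_seqHist.2 hm, inv_mem_seqHist.2 hn⟩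
    have hwx' : OccursBefore s (.ins w) (.ins x) :=
      key _ _ T₁ (by simp [hl, occursBefore_cons]) (by simp [hl]) (by simp [hl])
    have hyw : OccursBefore s (.ins y) (.rem (.inl w)) :=
      key _ _ T₁ (by simp [hl, occursBefore_cons]) (by simp [hl]) (by simp [hl])
    have hxz' : OccursBefore s (.rem (.inl x)) (.ins z) :=
      key _ _ T₂ (by simp [hl, occursBefore_cons]) (by simp [hl]) (by simp [hl])
    have hrem := (hqueue w x hwx' (hperm.mem_iff.2 (by simp [hl]))).2
    have hyz' := (hyw.trans hs hrem).trans hs hxz'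
    have hy := hperm.mem_iff.1 (hqueue y z hyz' (hperm.mem_iff.2 (by simp [hl]))).1
    simp [hl, hwy.symm, hxy.symm, hyz] at hy

/-- For queue, local linearizability is incomparable to sequential consistency. -/
theorem queue_locallyLinearizable_incomparable_seqConsistent
    (V E I : Type*) (w x y z : V)
    (hwx : w ≠ x) (hwy : w ≠ y) (hwz : w ≠ z)
    (hxy : x ≠ y) (hxz : x ≠ z) (hyz : y ≠ z)
    (T₁ T₂ : I) (hT : T₁ ≠ T₂) :
    (∃ h : List (Event (CMethod V E) I), IsHistory h ∧
        SeqConsistent (queueSpec V E) h ∧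
        ¬ LocallyLinearizable (queueSpec V E) h) ∧
    (∃ h : List (Event (CMethod V E) I), IsHistory h ∧
        LocallyLinearizable (queueSpec V E) h ∧
        ¬ SeqConsistent (queueSpec V E) h) := by
  exact ⟨exists_seqConsistent_not_locallyLinearizable V E x hT,
    exists_locallyLinearizable_not_seqConsistent V E hwx hwy hwz hxy hxz hyz hT⟩

end LL
end

section
/- Axiomatic characterization of queue linearizability: a complete concurrent history h over Σ_Q is linearizable with respect to S_Q if and only if (1) h, with enq read as ins and deq read as rem, is linearizable with respect to the pool specification S_P, and (2) for all x, y ∈ V: if enq(x) <_h enq(y) and deq(y) appears in h, then deq(x) appears in h and it is not the case that deq(y) <_h deq(x). -/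
namespace LL

section Helpers

variable {σ : Type*} {I : Type*} {V : Type*} {E : Type*} {α : Type*}

/-! ### Sequences -/

theorem OccursBefore.mem_left {s : List α} {a b : α} (hab : OccursBefore s a b) : a ∈ s := by
  obtain ⟨i, j, -, rfl, -⟩ := hab
  exact List.get_mem s i

theorem OccursBefore.mem_right {s : List α} {a b : α} (hab : OccursBefore s a b) : b ∈ s := by
  obtain ⟨i, j, -, -, rfl⟩ := hab
  exact List.get_mem s j

theorem OccursBefore.rel_of_pairwise {s : List α} {r : α → α → Prop} (hs : s.Pairwise r)
    {a b : α} (hab : OccursBefore s a b) : r a b := by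
  obtain ⟨i, j, hij, rfl, rfl⟩ := hab
  exact List.pairwise_iff_get.mp hs i j hij

theorem OccursBefore.of_pairwise {s : List α} {r : α → α → Prop} (hs : s.Pairwise r)
    (hr : ∀ a, r a a) {a b : α} (ha : a ∈ s) (hb : b ∈ s) (hba : ¬ r b a) :
    OccursBefore s a b := by
  obtain ⟨i, rfl⟩ := List.get_of_mem ha
  obtain ⟨j, rfl⟩ := List.get_of_mem hb
  rcases lt_trichotomy i j with hij | rfl | hji
  · exact ⟨i, j, hij, rfl, rfl⟩
  · exact absurd (hr _) hba
  · exact absurd (List.pairwise_iff_get.mp hs j i hji) hba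

theorem OccursBefore.ne {s : List α} (hs : s.Nodup) {a b : α} (hab : OccursBefore s a b) :
    a ≠ b :=
  hab.rel_of_pairwise hs

theorem OccursBefore.asymm {s : List α} (hs : s.Nodup) {a b : α} (hab : OccursBefore s a b) :
    ¬ OccursBefore s b a := by
  rintro ⟨i', j', hij', hb', ha'⟩
  obtain ⟨i, j, hij, ha, hb⟩ := hab
  have h1 : i = j' := List.nodup_iff_injective_get.mp hs (ha.trans ha'.symm)
  have h2 : j = i' := List.nodup_iff_injective_get.mp hs (hb.trans hb'.symm)
  subst h1 h2
  exact lt_asymm hij hij'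

theorem OccursBefore.idxOf_lt [DecidableEq α] {s : List α} (hs : s.Nodup) {a b : α}
    (hab : OccursBefore s a b) : s.idxOf a < s.idxOf b := by
  obtain ⟨i, j, hij, rfl, rfl⟩ := hab
  simpa [hs.idxOf_getElem] using hij

theorem OccursBefore.of_idxOf_lt [DecidableEq α] {s : List α} {a b : α} (hb : b ∈ s)
    (hab : s.idxOf a < s.idxOf b) : OccursBefore s a b := by
  have hb' : s.idxOf b < s.length := List.idxOf_lt_length_iff.mpr hb
  refine ⟨⟨s.idxOf a, hab.trans hb'⟩, ⟨s.idxOf b, hb'⟩, hab, ?_, ?_⟩ <;> simp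

/-! ### Histories -/

theorem mem_methodList_iff {h : List (Event σ I)} {m : σ} :
    m ∈ methodList h ↔ Appears h m := by
  simp only [methodList, List.mem_map, List.mem_filter, Appears]
  constructor
  · rintro ⟨e | e, ⟨he, hinv⟩, rfl⟩
    · exact ⟨_, he⟩
    · simp [Event.isInv] at hinv
  · rintro ⟨k, hk⟩
    exact ⟨_, ⟨hk, rfl⟩, rfl⟩

theorem isCompletionOf_iff_eq {h hc : List (Event σ I)} (hh : IsHistory h)
    (hcomp : HistComplete h) : IsCompletionOf hc h ↔ hc = h := by
  have hpend : ∀ m k, ¬ PendingCall h m k := fun m k hp => hp.2 (hcomp m k hp.1)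
  constructor
  · rintro ⟨-, -, h', r, hsub, hdel, hr, rfl⟩
    have hr' : r = [] := List.eq_nil_iff_forall_not_mem.mpr fun e he => by
      obtain ⟨m, k, -, hp⟩ := hr e he
      exact hpend m k hp
    have hmem : h ⊆ h' := fun e he => by
      by_contra hne
      obtain ⟨m, k, -, hp⟩ := hdel e he hne
      exact hpend m k hp
    rw [hr', List.append_nil]
    exact hsub.eq_of_length_le (hh.nodup.subperm hmem).length_le
  · rintro rfl
    exact ⟨hh, hcomp, hc, [], List.Sublist.refl _, fun e he hne => absurd he hne, by simp, by simp⟩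

theorem linearizable_iff_of_complete {S : Set (List σ)} {h : List (Event σ I)} (hh : IsHistory h)
    (hcomp : HistComplete h) :
    Linearizable S h ↔ ∃ s ∈ S, s.Perm (methodList h) ∧
      ∀ m n : σ, Precedes h m n → OccursBefore s m n := by
  simp only [Linearizable, isCompletionOf_iff_eq hh hcomp, exists_eq_left]

theorem not_precedes_self {h : List (Event σ I)} (hh : IsHistory h) (m : σ) :
    ¬ Precedes h m m := by
  rintro ⟨i, j, k, k', hij, hi, hj⟩
  obtain ⟨i₀, hi₀, hinv⟩ := hh.resMatched i m k hi
  have := hh.invUnique i₀ j m k k' hinv hj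
  omega

/-- The precedence relation is an interval order. -/
theorem Precedes.or_of_precedes {h : List (Event σ I)} {a b c d : σ} (hab : Precedes h a b)
    (hcd : Precedes h c d) : Precedes h a d ∨ Precedes h c b := by
  obtain ⟨i, j, k, l, hij, hi, hj⟩ := hab
  obtain ⟨i', j', k', l', hij', hi', hj'⟩ := hcd
  by_cases hlt : i < j'
  · exact Or.inl ⟨i, j', k, l', hlt, hi, hj'⟩
  · exact Or.inr ⟨i', j, k', l, by omega, hi', hj⟩

/-! ### Ordering the values -/

section ValueOrder

variable {M : Type*}

/-- The transitive closure of the order constraints that an interval order `lt` on method calls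
imposes on values `x` inserted by `a x` and removed by `b x`. -/
def ValuePrec (lt : M → M → Prop) (a b : V → M) (x y : V) : Prop :=
  lt (a x) (a y) ∨ lt (b x) (b y) ∨ lt (b x) (a y) ∨
    (∃ z, lt (a x) (a z) ∧ lt (b z) (b y)) ∨ (∃ z, lt (b x) (b z) ∧ lt (a z) (a y))

variable {lt : M → M → Prop} {a b : V → M}

theorem ValuePrec.trans
    (hlt : ∀ m, ¬ lt m m) (hint : ∀ m n p q, lt m n → lt p q → lt m q ∨ lt p n)
    (hba : ∀ x, ¬ lt (b x) (a x))
    (hq : ∀ x y, lt (a x) (a y) → ¬ lt (b y) (b x)) {x y z : V}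
    (hxy : ValuePrec lt a b x y) (hyz : ValuePrec lt a b y z) : ValuePrec lt a b x z := by
  have htr : ∀ m n p, lt m n → lt n p → lt m p := fun m n p h1 h2 =>
    (hint m n n p h1 h2).resolve_right (hlt n)
  have hA : ∀ x y z, lt (a x) (a y) → ValuePrec lt a b y z → ValuePrec lt a b x z := by
    rintro x y z h (h1 | h1 | h1 | ⟨w, h1, h2⟩ | ⟨w, h1, h2⟩)
    · exact Or.inl (htr _ _ _ h h1)
    · exact Or.inr (Or.inr (Or.inr (Or.inl ⟨y, h, h1⟩)))
    · exact Or.inl ((hint _ _ _ _ h h1).resolve_right (hba y))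
    · exact Or.inr (Or.inr (Or.inr (Or.inl ⟨w, htr _ _ _ h h1, h2⟩)))
    · exact Or.inl ((hint _ _ _ _ h h2).resolve_right fun h3 => hq _ _ h3 h1)
  have hB : ∀ x y z, lt (b x) (b y) → ValuePrec lt a b y z → ValuePrec lt a b x z := by
    rintro x y z h (h1 | h1 | h1 | ⟨w, h1, h2⟩ | ⟨w, h1, h2⟩)
    · exact Or.inr (Or.inr (Or.inr (Or.inr ⟨y, h, h1⟩)))
    · exact Or.inr (Or.inl (htr _ _ _ h h1))
    · exact Or.inr (Or.inr (Or.inl (htr _ _ _ h h1)))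
    · exact Or.inr (Or.inl ((hint _ _ _ _ h h2).resolve_right (hq _ _ h1)))
    · exact Or.inr (Or.inr (Or.inr (Or.inr ⟨w, htr _ _ _ h h1, h2⟩)))
  have hBA : ∀ x y, lt (b x) (a y) → ∀ w, lt (b y) w → lt (b x) w := fun x y h w h1 =>
    (hint _ _ _ _ h h1).resolve_right (hba y)
  rcases hxy with h | h | h | ⟨w, h, h'⟩ | ⟨w, h, h'⟩
  · exact hA _ _ _ h hyz
  · exact hB _ _ _ h hyz
  · rcases hyz with h1 | h1 | h1 | ⟨w, h1, h2⟩ | ⟨w, h1, h2⟩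
    · exact Or.inr (Or.inr (Or.inl (htr _ _ _ h h1)))
    · exact Or.inr (Or.inl (hBA _ _ h _ h1))
    · exact Or.inr (Or.inr (Or.inl (hBA _ _ h _ h1)))
    · exact Or.inr (Or.inl (hBA _ _ (htr _ _ _ h h1) _ h2))
    · exact Or.inr (Or.inr (Or.inr (Or.inr ⟨w, hBA _ _ h _ h1, h2⟩)))
  · exact hA _ _ _ h (hB _ _ _ h' hyz)
  · exact hB _ _ _ h (hA _ _ _ h' hyz)

theorem not_valuePrec_self (hlt : ∀ m, ¬ lt m m) (hba : ∀ x, ¬ lt (b x) (a x))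
    (hq : ∀ x y, lt (a x) (a y) → ¬ lt (b y) (b x)) (x : V) : ¬ ValuePrec lt a b x x := by
  rintro (h | h | h | ⟨w, h, h'⟩ | ⟨w, h, h'⟩)
  · exact hlt _ h
  · exact hlt _ h
  · exact hba _ h
  · exact hq _ _ h h'
  · exact hq _ _ h' h

/-- There is a linear order of the values in which removed values (those satisfying `R`) come
first and which is compatible with the precedence of insertions and removals. -/
theorem exists_value_order (R : V → Prop)
    (hlt : ∀ m, ¬ lt m m) (hint : ∀ m n p q, lt m n → lt p q → lt m q ∨ lt p n)
    (hba : ∀ x, ¬ lt (b x) (a x))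
    (hRl : ∀ x m, lt (b x) m → R x)
    (hR : ∀ x y, lt (a x) (a y) → R y → R x)
    (hq : ∀ x y, lt (a x) (a y) → ¬ lt (b y) (b x)) :
    ∃ le : V → V → Prop, IsLinearOrder V le ∧
      (∀ x y, R x → ¬ R y → le x y) ∧
      (∀ x y, lt (a x) (a y) → ¬ le y x) ∧
      (∀ x y, lt (b x) (b y) → ¬ le y x) ∧
      (∀ x y, lt (b x) (a y) → ¬ le y x) := by
  have hPR : ∀ x y, ValuePrec lt a b x y → R y → R x := by
    rintro x y (h | h | h | ⟨w, h, h'⟩ | ⟨w, h, h'⟩) hy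
    · exact hR _ _ h hy
    · exact hRl _ _ h
    · exact hRl _ _ h
    · exact hR _ _ h (hRl _ _ h')
    · exact hRl _ _ h
  have htr := @ValuePrec.trans _ _ lt a b hlt hint hba hq
  have hirr := not_valuePrec_self hlt hba hq
  let G : V → V → Prop := fun x y => x = y ∨ (R x ∧ ¬ R y) ∨ ((R x ↔ R y) ∧ ValuePrec lt a b x y)
  have hG : IsPartialOrder V G :=
    { refl := fun x => Or.inl rfl
      trans := by
        rintro x y z (rfl | h | h) (rfl | h' | h')
        · exact Or.inl rfl
        · exact Or.inr (Or.inl h')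
        · exact Or.inr (Or.inr h')
        · exact Or.inr (Or.inl h)
        · exact absurd h'.1 h.2
        · exact Or.inr (Or.inl ⟨h.1, fun hz => h.2 (h'.1.mpr hz)⟩)
        · exact Or.inr (Or.inr h)
        · exact Or.inr (Or.inl ⟨h.1.mpr h'.1, h'.2⟩)
        · exact Or.inr (Or.inr ⟨h.1.trans h'.1, htr h.2 h'.2⟩)
      antisymm := by
        rintro x y (rfl | h | h) (h'' | h' | h')
        · rfl
        · rfl
        · rfl
        · exact h''.symm
        · exact absurd h'.1 h.2
        · exact absurd (h'.1.mpr h.1) h.2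
        · exact h''.symm
        · exact absurd (h.1.mpr h'.1) h'.2
        · exact absurd (htr h.2 h'.2) (hirr x) }
  obtain ⟨le, hle, hGle⟩ := extend_partialOrder G
  have hP : ∀ x y, ValuePrec lt a b x y → ¬ le y x := by
    intro x y h hyx
    have hxy : le x y := by
      refine hGle _ _ ?_
      by_cases hx : R x
      · by_cases hy : R y
        · exact Or.inr (Or.inr ⟨by tauto, h⟩)
        · exact Or.inr (Or.inl ⟨hx, hy⟩)
      · exact Or.inr (Or.inr ⟨⟨fun h => absurd h hx, hPR _ _ h⟩, h⟩)
    have hEq : x = y := hle.antisymm _ _ hxy hyx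
    subst hEq
    exact hirr _ h
  exact ⟨le, hle, fun x y hx hy => hGle _ _ (Or.inr (Or.inl ⟨hx, hy⟩)),
    fun x y h => hP _ _ (Or.inl h), fun x y h => hP _ _ (Or.inr (Or.inl h)),
    fun x y h => hP _ _ (Or.inr (Or.inr (Or.inl h)))⟩

end ValueOrder

/-! ### Ordering the method calls -/

/-- The order on method calls induced by an order `le` on values and a precedence relation `lt`:
insertions and removals are ordered by value, and a removal goes before an insertion only
if this is forced by `lt`. -/
def MethodLE (lt : CMethod V E → CMethod V E → Prop) (le : V → V → Prop) :
    CMethod V E → CMethod V E → Prop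
  | .ins x, .ins y => le x y
  | .rem (Sum.inl x), .rem (Sum.inl y) => le x y
  | .rem (Sum.inl x), .ins y =>
      ∃ z w, le x z ∧ le w y ∧ lt (.rem (Sum.inl z)) (.ins w)
  | .ins y, .rem (Sum.inl x) =>
      ¬ ∃ z w, le x z ∧ le w y ∧ lt (.rem (Sum.inl z)) (.ins w)
  | .rem (Sum.inr _), _ => True
  | .ins _, .rem (Sum.inr _) => False
  | .rem (Sum.inl _), .rem (Sum.inr _) => False

section MethodOrder

variable {lt : CMethod V E → CMethod V E → Prop} {le : V → V → Prop}

theorem MethodLE.total (hle : IsLinearOrder V le) (m n : CMethod V E) :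
    MethodLE lt le m n ∨ MethodLE lt le n m := by
  rcases m with x | x | x <;> rcases n with y | y | y <;> simp only [MethodLE] <;>
    first
    | exact hle.total x y
    | tauto

theorem MethodLE.trans (hle : IsLinearOrder V le) {m n p : CMethod V E}
    (hmn : MethodLE lt le m n) (hnp : MethodLE lt le n p) : MethodLE lt le m p := by
  have htr : ∀ x y z, le x y → le y z → le x z := fun x y z => hle.trans x y z
  have htot : ∀ x y, le x y ∨ le y x := hle.total
  rcases m with x | x | x <;> rcases n with y | y | y <;> rcases p with z | z | z <;>
    simp only [MethodLE] at hmn hnp ⊢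
  · exact htr _ _ _ hmn hnp
  · rintro ⟨c, d, hc, hd, h⟩
    exact hnp ⟨c, d, hc, htr _ _ _ hd hmn, h⟩
  · obtain ⟨c, d, hc, hd, h⟩ := hnp
    refine (htot x z).resolve_right fun hzx => hmn ⟨c, d, hc, htr _ _ _ hd hzx, h⟩
  · rintro ⟨c, d, hc, hd, h⟩
    exact hmn ⟨c, d, htr _ _ _ hnp hc, hd, h⟩
  · obtain ⟨c, d, hc, hd, h⟩ := hmn
    exact ⟨c, d, hc, htr _ _ _ hd hnp, h⟩
  · obtain ⟨c, d, hc, hd, h⟩ := hmn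
    refine (htot x z).resolve_right fun hzx => hnp ⟨c, d, htr _ _ _ hzx hc, hd, h⟩
  · obtain ⟨c, d, hc, hd, h⟩ := hnp
    exact ⟨c, d, htr _ _ _ hmn hc, hd, h⟩
  · exact htr _ _ _ hmn hnp

theorem not_methodLE_rem_ins_self (hle : IsLinearOrder V le)
    (hremins : ∀ x y, lt (.rem (Sum.inl x)) (.ins y) → ¬ le y x) (x : V) :
    ¬ MethodLE lt le (.rem (Sum.inl x)) (.ins x) := by
  rintro ⟨c, d, hc, hd, h⟩
  exact hremins _ _ h (hle.trans _ _ _ hd hc)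

theorem not_methodLE_of_lt (hle : IsLinearOrder V le)
    (hint : ∀ m n p q, lt m n → lt p q → lt m q ∨ lt p n)
    (hins : ∀ x y, lt (.ins x) (.ins y) → ¬ le y x)
    (hrem : ∀ x y, lt (.rem (Sum.inl x)) (.rem (Sum.inl y)) → ¬ le y x)
    {m n : CMethod V E} (hm : ∀ e, m ≠ .rem (Sum.inr e)) (hn : ∀ e, n ≠ .rem (Sum.inr e))
    (hmn : lt m n) : ¬ MethodLE lt le n m := by
  rcases m with x | x | x <;> rcases n with y | y | y
  · exact hins _ _ hmn
  · rintro ⟨c, d, hc, hd, h⟩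
    rcases hint _ _ _ _ hmn h with h' | h'
    · exact hins _ _ h' hd
    · exact hrem _ _ h' hc
  · exact absurd rfl (hn y)
  · exact not_not_intro ⟨x, y, hle.refl x, hle.refl y, hmn⟩
  · exact hrem _ _ hmn
  · exact absurd rfl (hn y)
  all_goals exact absurd rfl (hm x)

end MethodOrder

/-! ### Blocks delimited by marked positions -/

section Block

variable (p : ℕ → Prop) [DecidablePred p]

/-- A monotone block index: marked positions form blocks of their own, and unmarked positions
share a block unless they are separated by a marked position. -/
def block (i : ℕ) : ℕ := Nat.count p (i + 1) + Nat.count p i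

theorem block_mono : Monotone (block p) := fun _ _ hij =>
  Nat.add_le_add (Nat.count_monotone p (Nat.succ_le_succ hij)) (Nat.count_monotone p hij)

variable {p}

theorem block_lt_of_left {i j : ℕ} (hi : p i) (hij : i < j) : block p i < block p j :=
  Nat.add_lt_add_of_le_of_lt (Nat.count_monotone p (Nat.succ_le_succ hij.le))
    (Nat.count_strict_mono hi hij)

theorem block_lt_of_right {i j : ℕ} (hj : p j) (hij : i < j) : block p i < block p j :=
  Nat.add_lt_add_of_lt_of_le
    ((Nat.count_monotone p (Nat.succ_le_of_lt hij)).trans_lt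
      (Nat.count_strict_mono hj (Nat.lt_succ_self j)))
    (Nat.count_monotone p hij.le)

theorem exists_between_of_block_lt {i j : ℕ} (hi : ¬ p i) (hj : ¬ p j)
    (hij : block p i < block p j) : ∃ k, i < k ∧ k < j ∧ p k := by
  simp only [block, Nat.count_succ, if_neg hi, if_neg hj, add_zero] at hij
  obtain ⟨k, ⟨hik, hkj⟩, hk⟩ := Nat.exists_of_count_lt_count (p := p) (a := i) (b := j) (by omega)
  refine ⟨k, lt_of_le_of_ne hik ?_, hkj, hk⟩
  rintro rfl
  exact hi hk

end Block

/-! ### Queue linearizations -/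

theorem exists_queueSpec_of_poolSpec {s : List (CMethod V E)} (hs : s ∈ poolSpec V E)
    {lt : CMethod V E → CMethod V E → Prop} (hlts : ∀ m n, lt m n → OccursBefore s m n)
    (hint : ∀ m n p q, lt m n → lt p q → lt m q ∨ lt p n)
    (hqueue : ∀ x y, lt (.ins x) (.ins y) → CMethod.rem (Sum.inl y) ∈ s →
      CMethod.rem (Sum.inl x) ∈ s ∧ ¬ lt (.rem (Sum.inl y)) (.rem (Sum.inl x))) :
    ∃ t ∈ queueSpec V E, t.Perm s ∧ ∀ m n, lt m n → OccursBefore t m n := by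
  classical
  obtain ⟨hnd, hrem, hemp⟩ := hs
  have hlt : ∀ m, ¬ lt m m := fun m h => (hlts m m h).ne hnd rfl
  obtain ⟨le, hle, hleR, hleI, hleD, hleDI⟩ :=
    exists_value_order (a := CMethod.ins) (b := fun x => CMethod.rem (Sum.inl x))
      (fun x => CMethod.rem (Sum.inl x) ∈ s) hlt hint
      (fun x h => (hlts _ _ h).asymm hnd (hrem x (hlts _ _ h).mem_left).2)
      (fun x m h => (hlts _ _ h).mem_left) (fun x y h hy => (hqueue x y h hy).1)
      (fun x y h h' => (hqueue x y h (hlts _ _ h').mem_left).2 h')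
  let p : ℕ → Prop := fun i => ∃ e : E, s[i]? = some (CMethod.rem (Sum.inr e))
  let seg : CMethod V E → ℕ := fun m => block p (s.idxOf m)
  have hget : ∀ m ∈ s, s[s.idxOf m]? = some m := fun m hm => List.getElem?_idxOf hm
  have hpE : ∀ e : E, CMethod.rem (Sum.inr e) ∈ s → p (s.idxOf (CMethod.rem (Sum.inr e))) :=
    fun e he => ⟨e, hget _ he⟩
  have hpN : ∀ m ∈ s, (∀ e : E, m ≠ CMethod.rem (Sum.inr e)) → ¬ p (s.idxOf m) := by
    rintro m hm hne ⟨e, he⟩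
    rw [hget m hm] at he
    exact hne e (Option.some.inj he)
  have hseg : ∀ m n, OccursBefore s m n → seg m ≤ seg n := fun m n h =>
    block_mono p (h.idxOf_lt hnd).le
  have hseg_right : ∀ m (e : E), OccursBefore s m (.rem (Sum.inr e)) →
      seg m < seg (.rem (Sum.inr e)) := fun m e h =>
    block_lt_of_right (hpE e h.mem_right) (h.idxOf_lt hnd)
  have hseg_left : ∀ m (e : E), OccursBefore s (.rem (Sum.inr e)) m →
      seg (.rem (Sum.inr e)) < seg m := fun m e h =>
    block_lt_of_left (hpE e h.mem_left) (h.idxOf_lt hnd)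
  have hseg_between : ∀ m ∈ s, ∀ n ∈ s, (∀ e : E, m ≠ .rem (Sum.inr e)) →
      (∀ e : E, n ≠ .rem (Sum.inr e)) → seg m < seg n →
      ∃ e : E, OccursBefore s m (.rem (Sum.inr e)) ∧ OccursBefore s (.rem (Sum.inr e)) n := by
    intro m hm n hn hm' hn' hmn
    obtain ⟨k, hmk, hkn, e, he⟩ := exists_between_of_block_lt (hpN m hm hm') (hpN n hn hn') hmn
    obtain ⟨hk, hke⟩ := List.getElem?_eq_some_iff.mp he
    have hidx : s.idxOf (CMethod.rem (Sum.inr e)) = k := by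
      rw [← hke]; exact hnd.idxOf_getElem k hk
    refine ⟨e, .of_idxOf_lt (hke ▸ List.getElem_mem hk) (by omega), .of_idxOf_lt hn (by omega)⟩
  have hseg_rem : ∀ x, CMethod.rem (Sum.inl x) ∈ s →
      seg (.rem (Sum.inl x)) = seg (.ins x) := by
    intro x hx
    obtain ⟨hi, hix⟩ := hrem x hx
    refine le_antisymm (not_lt.mp fun hlt' => ?_) (hseg _ _ hix)
    obtain ⟨e, h1, h2⟩ := hseg_between _ hi _ hx (by simp) (by simp) hlt'
    exact (hemp e x h1).2.asymm hnd h2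
  let r : CMethod V E → CMethod V E → Prop := fun m n =>
    seg m < seg n ∨ seg m = seg n ∧ MethodLE lt le m n
  have hr_total : ∀ m n, r m n ∨ r n m := by
    intro m n
    rcases lt_trichotomy (seg m) (seg n) with h | h | h
    · exact Or.inl (Or.inl h)
    · exact (MethodLE.total hle m n).imp (fun h' => Or.inr ⟨h, h'⟩) fun h' => Or.inr ⟨h.symm, h'⟩
    · exact Or.inr (Or.inl h)
  have hr_trans : ∀ l m n, r l m → r m n → r l n := by
    rintro l m n (h | ⟨h, h1⟩) (h' | ⟨h', h2⟩)
    · exact Or.inl (h.trans h')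
    · exact Or.inl (h'.symm ▸ h)
    · exact Or.inl (h ▸ h')
    · exact Or.inr ⟨h.trans h', h1.trans hle h2⟩
  have hr_le : ∀ m n, r m n → seg m ≤ seg n := by
    rintro m n (h | h)
    · exact h.le
    · exact h.1.le
  have : Std.Total r := ⟨hr_total⟩
  have : IsTrans _ r := ⟨hr_trans⟩
  have hsorted : (s.insertionSort r).Pairwise r := List.pairwise_insertionSort r s
  have hperm : (s.insertionSort r).Perm s := List.perm_insertionSort r s
  generalize s.insertionSort r = t at hsorted hperm
  have hmem : ∀ m, m ∈ t ↔ m ∈ s := fun m => hperm.mem_iff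
  have hndt : t.Nodup := hperm.nodup_iff.mpr hnd
  have hbefore : ∀ m n, m ∈ s → n ∈ s → ¬ r n m → OccursBefore t m n := fun m n hm hn h =>
    .of_pairwise hsorted (fun m => or_self_iff.mp (hr_total m m)) ((hmem m).mpr hm)
      ((hmem n).mpr hn) h
  refine ⟨t, ⟨⟨hndt, fun x hx => ?_, fun e x h => ?_⟩, fun x y h hy => ?_⟩, hperm,
    fun m n h => ?_⟩
  · rw [hmem] at hx
    refine ⟨(hmem _).mpr (hrem x hx).1, hbefore _ _ (hrem x hx).1 hx ?_⟩
    rintro (h | h)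
    · exact h.ne (hseg_rem x hx)
    · exact not_methodLE_rem_ins_self hle hleDI x h.2
  · have hi : CMethod.ins x ∈ s := (hmem _).mp h.mem_left
    have he : CMethod.rem (Sum.inr e) ∈ s := (hmem _).mp h.mem_right
    have hlt' : seg (.ins x) < seg (.rem (Sum.inr e)) :=
      (h.rel_of_pairwise hsorted).resolve_right fun h' => h'.2
    have hxe : OccursBefore s (.ins x) (.rem (Sum.inr e)) :=
      .of_idxOf_lt he (not_le.mp fun h' => hlt'.not_ge (block_mono p h'))
    obtain ⟨hx, hxe'⟩ := hemp e x hxe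
    exact ⟨(hmem _).mpr hx, hbefore _ _ hx he fun h' =>
      (hr_le _ _ h').not_gt (hseg_right _ _ hxe')⟩
  · rw [hmem] at hy ⊢
    have hx : CMethod.ins x ∈ s := (hmem _).mp h.mem_left
    have hxy : x ≠ y := fun hxy => h.ne hndt (congrArg _ hxy)
    rcases h.rel_of_pairwise hsorted with hlt' | ⟨heq, hxy'⟩
    · obtain ⟨e, h1, h2⟩ := hseg_between _ hx _ (hrem y hy).1 (by simp) (by simp) hlt'
      refine ⟨(hemp e x h1).1, hbefore _ _ (hemp e x h1).1 hy fun h' => (hr_le _ _ h').not_gt ?_⟩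
      rwa [hseg_rem x (hemp e x h1).1, hseg_rem y hy]
    · have hyx : ¬ le y x := fun h' => hxy (hle.antisymm _ _ hxy' h')
      have hxR : CMethod.rem (Sum.inl x) ∈ s := by
        by_contra hxR
        exact hyx (hleR y x hy hxR)
      refine ⟨hxR, hbefore _ _ hxR hy ?_⟩
      rintro (h' | h')
      · rw [hseg_rem x hxR, hseg_rem y hy, heq] at h'
        exact lt_irrefl _ h'
      · exact hyx h'.2
  · have hmn := hlts m n h
    refine hbefore _ _ hmn.mem_left hmn.mem_right ?_
    rintro (h' | ⟨heq, h'⟩)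
    · exact h'.not_ge (hseg _ _ hmn)
    · refine not_methodLE_of_lt hle hint hleI hleD ?_ ?_ h h'
      · rintro e rfl
        exact (hseg_left _ _ hmn).ne' heq
      · rintro e rfl
        exact (hseg_right _ _ hmn).ne' heq

end Helpers

/-- Axiomatic characterization of queue linearizability: a complete history is
linearizable wrt the queue specification iff it is linearizable wrt the pool
specification and satisfies the concurrent queue order axiom. -/
theorem queue_linearizability_characterization
    (V E I : Type*) (h : List (Event (CMethod V E) I))
    (hh : IsHistory h) (hcomp : HistComplete h) :
    Linearizable (queueSpec V E) h ↔
      (Linearizable (poolSpec V E) h ∧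
        ∀ x y : V, Precedes h (CMethod.ins x) (CMethod.ins y) →
          Appears h (CMethod.rem (Sum.inl y)) →
          Appears h (CMethod.rem (Sum.inl x)) ∧
          ¬ Precedes h (CMethod.rem (Sum.inl y)) (CMethod.rem (Sum.inl x))) := by
  simp only [linearizable_iff_of_complete hh hcomp, ← mem_methodList_iff]
  constructor
  · rintro ⟨s, ⟨hpool, hqueue⟩, hperm, hprec⟩
    refine ⟨⟨s, hpool, hperm, hprec⟩, fun x y hxy hy => ?_⟩
    obtain ⟨hx, hyx⟩ := hqueue x y (hprec _ _ hxy) (hperm.mem_iff.mpr hy)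
    exact ⟨hperm.mem_iff.mp hx, fun h' => hyx.asymm hpool.1 (hprec _ _ h')⟩
  · rintro ⟨⟨s, hpool, hperm, hprec⟩, hqueue⟩
    obtain ⟨t, ht, hts, htprec⟩ := exists_queueSpec_of_poolSpec hpool hprec
      (fun _ _ _ _ => Precedes.or_of_precedes) (by simpa only [hperm.mem_iff] using hqueue)
    exact ⟨t, ht, hts.trans hperm, htprec⟩

end LL
end
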